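/- Fix integers n, m ≥ 1, k₁ ≥ 0, k₂ ≥ 0 and N ≥ 0. If k₂ is odd, then for all x ∈ ℝ^{2n} and t ∈ ℝ^m, |p_{1,k₁,k₂}(x,t) − Σ_{h=0}^{N} (|t|^{2h+1}/(2h+1)!) · p_{1,k₁,k₂+2h+1}(x,0)| ≤ (|t|^{2N+3}/(2N+3)!) · |p_{1,k₁,k₂+2N+3}(x,0)|. If k₂ is even, then for all x ∈ ℝ^{2n} and t ∈ ℝ^m, |p_{1,k₁,k₂}(x,t) − Σ_{h=0}^{N} (|t|^{2h}/(2h)!) · p_{1,k₁,k₂+2h}(x,0)| ≤ (|t|^{2N+2}/(2N+2)!) · |p_{1,k₁,k₂+2N+2}(x,0)|. -/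

import Mathlib

open Real Complex MeasureTheory
open scoped Classical

/-- The radial derivative p_{1,k₁,j} of the heat kernel at time 1 on an H-type group
with centre of dimension m, with R = |x|²/4 (integrand extended by continuity at λ = 0). -/
noncomputable def pT (n m k₁ k₂ : ℕ) (hm : 0 < m)
    (x : EuclideanSpace ℝ (Fin (2 * n))) (t : EuclideanSpace ℝ (Fin m)) : ℂ :=
  ((-1 : ℂ) ^ k₁ * Complex.I ^ k₂ / ((4 * (π : ℂ)) ^ n * (2 * (π : ℂ)) ^ m)) *
    ∫ lam : EuclideanSpace ℝ (Fin m),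
      if lam = 0 then (if k₂ = 0 then Complex.exp (-((‖x‖ ^ 2 / 4 : ℝ) : ℂ)) else 0)
      else
        Complex.exp (Complex.I * ((‖t‖ : ℝ) : ℂ) * ((lam ⟨0, hm⟩ : ℝ) : ℂ)
            - ((‖x‖ ^ 2 / 4 * ‖lam‖ * Real.cosh ‖lam‖ / Real.sinh ‖lam‖ : ℝ) : ℂ)) *
          (((‖lam‖ : ℝ) : ℂ) ^ (n + k₁) * ((Real.cosh ‖lam‖ : ℝ) : ℂ) ^ k₁
            / ((Real.sinh ‖lam‖ : ℝ) : ℂ) ^ (n + k₁)) *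
          ((lam ⟨0, hm⟩ : ℝ) : ℂ) ^ k₂

/-- Taylor remainder of the exponential along a ray of the closed left half-plane. -/
lemma norm_exp_mul_sub_sum_le_of_nonneg {c : ℂ} (hre : c.re ≤ 0) (hc : ‖c‖ ≤ 1) (M : ℕ) :
    ∀ y : ℝ, 0 ≤ y →
      ‖Complex.exp (c * y) - ∑ j ∈ Finset.range M, (c * y) ^ j / (Nat.factorial j : ℂ)‖
        ≤ y ^ M / Nat.factorial M := by
  induction M with
  | zero =>
    intro y hy
    simpa [Complex.norm_exp] using mul_nonpos_of_nonpos_of_nonneg hre hy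
  | succ M ih =>
    intro y hy
    have hlin (z : ℝ) : HasDerivAt (fun z : ℝ => c * (z : ℂ)) c z := by
      simpa using (Complex.ofRealCLM.hasDerivAt (x := z)).const_mul c
    have hpow (z : ℝ) (j : ℕ) : HasDerivAt
        (fun z : ℝ => (c * (z : ℂ)) ^ (j + 1) / (Nat.factorial (j + 1) : ℂ))
        (c * ((c * z) ^ j / (Nat.factorial j : ℂ))) z := by
      refine (((hlin z).pow (j + 1)).div_const (Nat.factorial (j + 1) : ℂ)).congr_deriv ?_
      have h1 : (Nat.factorial j : ℂ) ≠ 0 := by exact_mod_cast j.factorial_ne_zero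
      have h2 : ((j : ℂ) + 1) ≠ 0 := by exact_mod_cast j.succ_ne_zero
      rw [Nat.factorial_succ]
      push_cast
      field_simp
    have hf (z : ℝ) : HasDerivAt
        (fun z : ℝ => Complex.exp (c * z)
          - ∑ j ∈ Finset.range (M + 1), (c * (z : ℂ)) ^ j / (Nat.factorial j : ℂ))
        (c * (Complex.exp (c * z)
          - ∑ j ∈ Finset.range M, (c * (z : ℂ)) ^ j / (Nat.factorial j : ℂ))) z := by
      simp only [Finset.sum_range_succ', pow_zero]
      refine ((hlin z).cexp.fun_sub ((HasDerivAt.fun_sum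
        fun j (_ : j ∈ Finset.range M) => hpow z j).add_const _)).congr_deriv ?_
      rw [mul_sub, Finset.mul_sum, mul_comm]
    have hB (z : ℝ) : HasDerivAt (fun z : ℝ => z ^ (M + 1) / (Nat.factorial (M + 1) : ℝ))
        (z ^ M / Nat.factorial M) z := by
      refine ((hasDerivAt_pow (M + 1) z).div_const (Nat.factorial (M + 1) : ℝ)).congr_deriv ?_
      have h1 : (Nat.factorial M : ℝ) ≠ 0 := by exact_mod_cast M.factorial_ne_zero
      have h2 : ((M : ℝ) + 1) ≠ 0 := by exact_mod_cast M.succ_ne_zero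
      rw [Nat.factorial_succ]
      push_cast
      field_simp
    refine image_norm_le_of_norm_deriv_right_le_deriv_boundary
      (f' := fun z : ℝ => c * (Complex.exp (c * z)
          - ∑ j ∈ Finset.range M, (c * (z : ℂ)) ^ j / (Nat.factorial j : ℂ)))
      (a := 0) (b := y)
      (fun z _ => (hf z).continuousAt.continuousWithinAt) (fun z _ => (hf z).hasDerivWithinAt)
      ?_ hB ?_ ⟨hy, le_rfl⟩
    · simp [Finset.sum_range_succ']
    · intro z hz
      rw [norm_mul]
      exact (mul_le_of_le_one_left (norm_nonneg _) hc).trans (ih z hz.1)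

/-- Sharp Taylor remainder bound for `y ↦ exp (I * y)` on the real line. -/
lemma norm_exp_I_mul_sub_sum_le (M : ℕ) (y : ℝ) :
    ‖Complex.exp (Complex.I * y)
        - ∑ j ∈ Finset.range M, (Complex.I * y) ^ j / (Nat.factorial j : ℂ)‖
      ≤ |y| ^ M / Nat.factorial M := by
  rcases le_total 0 y with hy | hy
  · rw [abs_of_nonneg hy]
    exact norm_exp_mul_sub_sum_le_of_nonneg (by simp) (by simp) M y hy
  · rw [abs_of_nonpos hy]
    simpa using norm_exp_mul_sub_sum_le_of_nonneg (c := -Complex.I) (by simp) (by simp) M (-y)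
      (by linarith)

/-- The modulus of the integrand of `pT` at frequency `lam`, without the power of `lam₁`. -/
noncomputable def weight (n m k₁ : ℕ) (x : EuclideanSpace ℝ (Fin (2 * n)))
    (lam : EuclideanSpace ℝ (Fin m)) : ℝ :=
  Real.exp (-(‖x‖ ^ 2 / 4 * ‖lam‖ * Real.cosh ‖lam‖ / Real.sinh ‖lam‖)) *
    (‖lam‖ ^ (n + k₁) * Real.cosh ‖lam‖ ^ k₁ / Real.sinh ‖lam‖ ^ (n + k₁))

lemma weight_nonneg (n m k₁ : ℕ) (x : EuclideanSpace ℝ (Fin (2 * n)))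
    (lam : EuclideanSpace ℝ (Fin m)) : 0 ≤ weight n m k₁ x lam := by
  have := Real.sinh_nonneg_iff.2 (norm_nonneg lam)
  have := (Real.cosh_pos ‖lam‖).le
  unfold weight
  positivity

lemma weight_neg (n m k₁ : ℕ) (x : EuclideanSpace ℝ (Fin (2 * n)))
    (lam : EuclideanSpace ℝ (Fin m)) : weight n m k₁ x (-lam) = weight n m k₁ x lam := by
  simp [weight]

lemma measurable_weight (n m k₁ : ℕ) (x : EuclideanSpace ℝ (Fin (2 * n))) :
    Measurable (weight n m k₁ x) := by
  unfold weight
  fun_prop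

lemma mul_cosh_div_sinh_le {u : ℝ} (hu : 0 ≤ u) :
    u * Real.cosh u / Real.sinh u ≤ 1 + u := by
  rcases hu.eq_or_lt with rfl | hu
  · simp
  rw [div_le_iff₀ (Real.sinh_pos_iff.2 hu)]
  have h1 := Real.cosh_sub_sinh u
  have h2 : Real.exp (-u) ≤ 1 := Real.exp_le_one_iff.2 (by linarith)
  have h3 := Real.self_le_sinh_iff.2 hu.le
  nlinarith

lemma div_sinh_le {u : ℝ} (hu : 0 ≤ u) :
    u / Real.sinh u ≤ 2 * (1 + u) * Real.exp (-u) := by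
  have h := mul_cosh_div_sinh_le hu
  have hc : Real.exp u ≤ 2 * Real.cosh u := by
    rw [Real.cosh_eq]; linarith [Real.exp_pos (-u)]
  have hd : 0 ≤ u / Real.sinh u := div_nonneg hu (Real.sinh_nonneg_iff.2 hu)
  have h4 : u / Real.sinh u * Real.exp u ≤ 2 * (1 + u) := by
    calc _ ≤ u / Real.sinh u * (2 * Real.cosh u) := by gcongr
      _ = 2 * (u * Real.cosh u / Real.sinh u) := by ring
      _ ≤ _ := by linarith
  calc u / Real.sinh u = u / Real.sinh u * Real.exp u * Real.exp (-u) := by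
        rw [mul_assoc, ← Real.exp_add]; simp
    _ ≤ _ := by gcongr

lemma weight_le {n : ℕ} (hn : 1 ≤ n) (m k₁ : ℕ) (x : EuclideanSpace ℝ (Fin (2 * n)))
    (lam : EuclideanSpace ℝ (Fin m)) :
    weight n m k₁ x lam ≤ 2 * (1 + ‖lam‖) ^ (k₁ + 1) * Real.exp (-‖lam‖) := by
  unfold weight
  set u := ‖lam‖
  have hu : 0 ≤ u := norm_nonneg lam
  have hs := Real.sinh_nonneg_iff.2 hu
  have hc := (Real.cosh_pos u).le
  have hd : 0 ≤ u / Real.sinh u := div_nonneg hu hs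
  have hd1 : u / Real.sinh u ≤ 1 := div_le_one_of_le₀ (Real.self_le_sinh_iff.2 hu) hs
  have he : Real.exp (-(‖x‖ ^ 2 / 4 * u * Real.cosh u / Real.sinh u)) ≤ 1 :=
    Real.exp_le_one_iff.2 (neg_nonpos.2 (by positivity))
  calc _ ≤ 1 * (u ^ (n + k₁) * Real.cosh u ^ k₁ / Real.sinh u ^ (n + k₁)) := by gcongr
    _ = (u * Real.cosh u / Real.sinh u) ^ k₁ * (u / Real.sinh u) ^ n := by
        rw [pow_add, pow_add, div_pow, div_pow, mul_pow]; ring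
    _ ≤ (1 + u) ^ k₁ * (u / Real.sinh u) ^ 1 := by
        gcongr ?_ ^ k₁ * ?_
        · exact mul_cosh_div_sinh_le hu
        · exact pow_le_pow_of_le_one hd hd1 hn
    _ ≤ (1 + u) ^ k₁ * (2 * (1 + u) * Real.exp (-u)) := by
        rw [pow_one]; gcongr; exact div_sinh_le hu
    _ = _ := by ring

lemma integrable_weight_mul_pow {n : ℕ} (hn : 1 ≤ n) (m k₁ j : ℕ) (i : Fin m)
    (x : EuclideanSpace ℝ (Fin (2 * n))) :
    Integrable fun lam : EuclideanSpace ℝ (Fin m) => weight n m k₁ x lam * lam i ^ j := by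
  set M := (k₁ + 1) + j + (m + 1)
  have h_int : Integrable fun lam : EuclideanSpace ℝ (Fin m) =>
      (2 * Real.exp 1 * Nat.factorial M) * (1 + ‖lam‖) ^ (-((m + 1 : ℕ) : ℝ)) :=
    (integrable_one_add_norm (by simp)).const_mul _
  refine h_int.mono' ?_ (Filter.Eventually.of_forall fun lam => ?_)
  · exact ((measurable_weight n m k₁ x).mul (by fun_prop)).aestronglyMeasurable
  rw [norm_mul, Real.norm_of_nonneg (weight_nonneg ..), norm_pow, Real.rpow_neg (by positivity),
    Real.rpow_natCast]
  have hw := weight_le hn m k₁ x lam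
  have hi : ‖lam i‖ ≤ 1 + ‖lam‖ := (PiLp.norm_apply_le lam i).trans (by linarith)
  set u := ‖lam‖
  have hu : 0 < 1 + u := by have : 0 ≤ u := norm_nonneg lam; linarith
  have hM : (1 + u) ^ M ≤ Nat.factorial M * (Real.exp 1 * Real.exp u) := by
    have := Real.pow_div_factorial_le_exp (1 + u) hu.le M
    rwa [div_le_iff₀' (by positivity), Real.exp_add] at this
  calc _ ≤ (2 * (1 + u) ^ (k₁ + 1) * Real.exp (-u)) * (1 + u) ^ j := by gcongr
    _ = 2 * (1 + u) ^ M * Real.exp (-u) * ((1 + u) ^ (m + 1))⁻¹ := by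
        simp only [M, pow_add]
        field_simp
    _ ≤ 2 * (Nat.factorial M * (Real.exp 1 * Real.exp u)) * Real.exp (-u)
          * ((1 + u) ^ (m + 1))⁻¹ := by gcongr
    _ = _ := by
        rw [Real.exp_neg]
        field_simp

/-- The constant in front of the integral defining `pT`, without the power of `I`. -/
noncomputable def prefactor (n m k₁ : ℕ) : ℂ :=
  (-1 : ℂ) ^ k₁ / ((4 * (π : ℂ)) ^ n * (2 * (π : ℂ)) ^ m)

lemma pT_eq (n m k₁ k₂ : ℕ) (hm : 0 < m)
    (x : EuclideanSpace ℝ (Fin (2 * n))) (t : EuclideanSpace ℝ (Fin m)) :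
    pT n m k₁ k₂ hm x t = prefactor n m k₁ * (Complex.I ^ k₂ *
      ∫ lam : EuclideanSpace ℝ (Fin m), Complex.exp (Complex.I * ((‖t‖ * lam ⟨0, hm⟩ : ℝ) : ℂ)) *
        ((weight n m k₁ x lam * lam ⟨0, hm⟩ ^ k₂ : ℝ) : ℂ)) := by
  have : Nonempty (Fin m) := ⟨⟨0, hm⟩⟩
  rw [pT, prefactor, ← mul_assoc]
  congr 1
  · ring
  refine integral_congr_ae ?_
  filter_upwards [compl_mem_ae_iff.2 (measure_singleton (0 : EuclideanSpace ℝ (Fin m)))]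
    with lam hlam
  rw [if_neg (show lam ≠ 0 from hlam), weight, sub_eq_add_neg, Complex.exp_add]
  push_cast
  ring_nf

lemma pT_zero_eq (n m k₁ k₂ : ℕ) (hm : 0 < m) (x : EuclideanSpace ℝ (Fin (2 * n))) :
    pT n m k₁ k₂ hm x 0 = prefactor n m k₁ * (Complex.I ^ k₂ *
      ((∫ lam : EuclideanSpace ℝ (Fin m), weight n m k₁ x lam * lam ⟨0, hm⟩ ^ k₂ : ℝ) : ℂ)) := by
  rw [pT_eq, ← integral_complex_ofReal]
  simp

lemma pT_zero_eq_zero_of_odd (n m k₁ : ℕ) {k₂ : ℕ} (hk : Odd k₂) (hm : 0 < m)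
    (x : EuclideanSpace ℝ (Fin (2 * n))) : pT n m k₁ k₂ hm x 0 = 0 := by
  have h := integral_neg_eq_self
    (fun lam : EuclideanSpace ℝ (Fin m) => weight n m k₁ x lam * lam ⟨0, hm⟩ ^ k₂) volume
  simp only [weight_neg, PiLp.neg_apply, hk.neg_pow, mul_neg, integral_neg] at h
  rw [pT_zero_eq, show ∫ lam : EuclideanSpace ℝ (Fin m),
    weight n m k₁ x lam * lam ⟨0, hm⟩ ^ k₂ = 0 by linarith]
  simp

/-- Taylor expansion of `pT` in `‖t‖` to any order at which the derivative is an even moment. -/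
lemma norm_pT_sub_sum_le {n : ℕ} (hn : 1 ≤ n) (m k₁ k₂ M : ℕ) (hM : Even (k₂ + M)) (hm : 0 < m)
    (x : EuclideanSpace ℝ (Fin (2 * n))) (t : EuclideanSpace ℝ (Fin m)) :
    ‖pT n m k₁ k₂ hm x t - ∑ j ∈ Finset.range M,
        ((‖t‖ ^ j / Nat.factorial j : ℝ) : ℂ) * pT n m k₁ (k₂ + j) hm x 0‖
      ≤ ‖t‖ ^ M / Nat.factorial M * ‖pT n m k₁ (k₂ + M) hm x 0‖ := by
  set i : Fin m := ⟨0, hm⟩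
  set s := ‖t‖
  set w := weight n m k₁ x
  have h_int (j : ℕ) : Integrable fun lam : EuclideanSpace ℝ (Fin m) => w lam * lam i ^ j :=
    integrable_weight_mul_pow hn m k₁ j i x
  have h_intC (j : ℕ) : Integrable fun lam : EuclideanSpace ℝ (Fin m) =>
      (Complex.I * ((s * lam i : ℝ) : ℂ)) ^ j / (Nat.factorial j : ℂ)
        * ((w lam * lam i ^ k₂ : ℝ) : ℂ) := by
    refine ((h_int (k₂ + j)).ofReal.const_mul
      ((Complex.I * (s : ℂ)) ^ j / (Nat.factorial j : ℂ))).congr (Filter.Eventually.of_forall ?_)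
    intro lam
    simp only [Complex.coe_algebraMap, pow_add]
    push_cast
    ring
  have hexp : Integrable fun lam : EuclideanSpace ℝ (Fin m) =>
      Complex.exp (Complex.I * ((s * lam i : ℝ) : ℂ)) * ((w lam * lam i ^ k₂ : ℝ) : ℂ) := by
    refine (h_int k₂).ofReal.bdd_mul (c := 1) ?_ ?_
    · exact (by fun_prop : Continuous fun lam : EuclideanSpace ℝ (Fin m) =>
        Complex.exp (Complex.I * ((s * lam i : ℝ) : ℂ))).aestronglyMeasurable
    · refine Filter.Eventually.of_forall fun lam => ?_
      rw [mul_comm, Complex.norm_exp_ofReal_mul_I]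
  have hterm (j : ℕ) :
      ((s ^ j / Nat.factorial j : ℝ) : ℂ) * pT n m k₁ (k₂ + j) hm x 0 =
        prefactor n m k₁ * (Complex.I ^ k₂ * ∫ lam : EuclideanSpace ℝ (Fin m),
          (Complex.I * ((s * lam i : ℝ) : ℂ)) ^ j / (Nat.factorial j : ℂ)
            * ((w lam * lam i ^ k₂ : ℝ) : ℂ)) := by
    rw [pT_zero_eq, ← integral_complex_ofReal]
    have : ∀ lam : EuclideanSpace ℝ (Fin m),
        (Complex.I * ((s * lam i : ℝ) : ℂ)) ^ j / (Nat.factorial j : ℂ)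
            * ((w lam * lam i ^ k₂ : ℝ) : ℂ) =
        (Complex.I * (s : ℂ)) ^ j / (Nat.factorial j : ℂ)
          * ((w lam * lam i ^ (k₂ + j) : ℝ) : ℂ) := by
      intro lam
      push_cast
      ring
    simp_rw [this]
    rw [integral_const_mul]
    push_cast
    ring
  have hnonneg (lam : EuclideanSpace ℝ (Fin m)) : 0 ≤ w lam * lam i ^ (k₂ + M) :=
    mul_nonneg (weight_nonneg ..) (hM.pow_nonneg _)
  simp_rw [hterm]
  rw [pT_eq, pT_zero_eq, ← Finset.mul_sum, ← Finset.mul_sum, ← mul_sub, ← mul_sub,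
    ← integral_finsetSum _ fun j _ => h_intC j,
    ← integral_sub hexp (integrable_finsetSum _ fun j _ => h_intC j)]
  simp only [norm_mul, norm_pow, Complex.norm_I, one_pow, one_mul]
  rw [Complex.norm_of_nonneg (integral_nonneg hnonneg), mul_left_comm]
  refine mul_le_mul_of_nonneg_left ?_ (norm_nonneg _)
  rw [← integral_const_mul]
  refine norm_integral_le_of_norm_le ((h_int (k₂ + M)).const_mul _)
    (Filter.Eventually.of_forall fun lam => ?_)
  rw [← Finset.sum_mul, ← sub_mul, norm_mul, Complex.norm_real, Real.norm_eq_abs, abs_mul,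
    abs_of_nonneg (weight_nonneg ..)]
  calc _ ≤ |s * lam i| ^ M / Nat.factorial M * (w lam * |lam i ^ k₂|) := by
        gcongr
        · exact mul_nonneg (weight_nonneg ..) (abs_nonneg _)
        · exact norm_exp_I_mul_sub_sum_le M _
    _ = s ^ M / Nat.factorial M * (w lam * |lam i| ^ (k₂ + M)) := by
        rw [abs_mul, abs_of_nonneg (norm_nonneg t), abs_pow]
        ring
    _ = _ := by rw [hM.pow_abs]

lemma sum_range_eq_sum_even (f : ℕ → ℂ) (hf : ∀ j, Odd j → f j = 0) (N : ℕ) :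
    ∑ j ∈ Finset.range (2 * N), f j = ∑ h ∈ Finset.range N, f (2 * h) := by
  induction N with
  | zero => simp
  | succ N ih =>
    rw [mul_add, mul_one, Finset.sum_range_succ, Finset.sum_range_succ, ih,
      Finset.sum_range_succ, hf (2 * N + 1) (odd_two_mul_add_one N), add_zero]

/-- Taylor expansion of p_{1,k₁,k₂}(x,t) in |t| around |t| = 0, with explicit remainder
bounds: the odd and even cases of k₂. -/
theorem taylor_in_t (n m k₁ k₂ N : ℕ) (hn : 1 ≤ n) (hm : 0 < m) :
    (Odd k₂ → ∀ (x : EuclideanSpace ℝ (Fin (2 * n))) (t : EuclideanSpace ℝ (Fin m)),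
      ‖pT n m k₁ k₂ hm x t -
          ∑ h ∈ Finset.range (N + 1),
            (((‖t‖ ^ (2 * h + 1) / (Nat.factorial (2 * h + 1)) : ℝ) : ℂ)) *
              pT n m k₁ (k₂ + 2 * h + 1) hm x 0‖
        ≤ (‖t‖ ^ (2 * N + 3) / (Nat.factorial (2 * N + 3))) *
            ‖pT n m k₁ (k₂ + 2 * N + 3) hm x 0‖) ∧
    (Even k₂ → ∀ (x : EuclideanSpace ℝ (Fin (2 * n))) (t : EuclideanSpace ℝ (Fin m)),
      ‖pT n m k₁ k₂ hm x t -
          ∑ h ∈ Finset.range (N + 1),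
            (((‖t‖ ^ (2 * h) / (Nat.factorial (2 * h)) : ℝ) : ℂ)) *
              pT n m k₁ (k₂ + 2 * h) hm x 0‖
        ≤ (‖t‖ ^ (2 * N + 2) / (Nat.factorial (2 * N + 2))) *
            ‖pT n m k₁ (k₂ + 2 * N + 2) hm x 0‖) := by
  constructor
  · intro hk x t
    have h := norm_pT_sub_sum_le hn m k₁ k₂ (2 * N + 3) (hk.add_odd ⟨N + 1, by ring⟩) hm x t
    have h0 : pT n m k₁ (k₂ + 0) hm x 0 = 0 := pT_zero_eq_zero_of_odd n m k₁ hk hm x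
    rw [Finset.sum_range_succ', h0, mul_zero, add_zero, show 2 * N + 2 = 2 * (N + 1) by ring,
      sum_range_eq_sum_even] at h
    · exact h
    · intro j hj
      rw [pT_zero_eq_zero_of_odd n m k₁ (hk.add_even (hj.add_odd odd_one)), mul_zero]
  · intro hk x t
    have h := norm_pT_sub_sum_le hn m k₁ k₂ (2 * N + 2) (hk.add ⟨N + 1, by ring⟩) hm x t
    rw [show 2 * N + 2 = 2 * (N + 1) by ring, sum_range_eq_sum_even] at h
    · exact h
    · intro j hj
      rw [pT_zero_eq_zero_of_odd n m k₁ (hk.add_odd hj), mul_zero]
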